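/- arXiv:2511.17877 — 6 statements merged into one kernel-verified Lean document; each statement's English description precedes it below -/
import Mathlib

section
/- Let p₀ and q₀ be coprime integers with p₀ ≠ 0 and |q₀| > 1, and let k be an integer such that the rational number p₀/q₀ lies in the open interval (k, k+1). Then there exist integers p₁, q₁, p₂, q₂, p₃, q₃ such that: (1) for each i = 1, 2, 3 the integers pᵢ and qᵢ are coprime; (2) for each i = 1, 2, 3, if pᵢ ≠ 0 then sign(pᵢ) = sign(p₀), and if qᵢ ≠ 0 then sign(qᵢ) = sign(q₀); (3) q₁ ≠ 0, q₂ ≠ 0, and the rationals p₁/q₁ and p₂/q₂ lie in the closed interval [k, k+1]; (4) p₁ + p₂ = p₀ and q₁ + q₂ = q₀; (5) p₃ = sign(p₀)·|p₁ − p₂| and q₃ = sign(q₀)·|q₁ − q₂|; (6) there exist signs σ₁, σ₂, σ₃ ∈ {1, −1} and ε, ε′ ∈ {1, −1} such that, writing pᵢ′ = σᵢ·pᵢ and qᵢ′ = σᵢ·qᵢ for i = 1, 2, 3, one has p₀q₁′ − p₁′q₀ = p₁′q₂′ − p₂′q₁′ = p₂′q₀ − p₀q₂′ = ε and p₂′q₃′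 − p₃′q₂′ = p₁′q₃′ − p₃′q₁′ = ε′. -/
/-- A fraction `p / q` strictly between `k` and `k + 1` is the mediant of two fractions in
`[k, k + 1]` with positive denominators and determinant one. -/
theorem exists_mediant_decomposition {p q k : ℤ} (hcop : IsCoprime p q) (hq : 1 < q)
    (hk : k * q < p) (hk' : p < (k + 1) * q) :
    ∃ a b c d : ℤ, 0 < b ∧ 0 < d ∧ k * b ≤ a ∧ a ≤ (k + 1) * b ∧ k * d ≤ c ∧ c ≤ (k + 1) * d ∧
      a + c = p ∧ b + d = q ∧ c * b - a * d = 1 := by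
  obtain ⟨u, v, huv⟩ := hcop
  have hdiv := Int.emod_add_mul_ediv u q
  have hb0 : 0 ≤ u % q := Int.emod_nonneg _ (by lia)
  have hbq : u % q < q := Int.emod_lt_of_pos _ (by lia)
  set b := u % q
  set a := -v - p * (u / q) with ha
  have hdet : p * b - a * q = 1 := by rw [ha]; linear_combination huv + p * hdiv
  have hb : 0 < b := by
    refine lt_of_le_of_ne hb0 fun h => ?_
    rw [← h] at hdet
    have hunit : q ∣ 1 := ⟨-a, by linarith⟩
    have := Int.le_of_dvd one_pos hunit
    lia
  have hd : 0 < q - b := by lia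
  have hq' : 0 < q := by lia
  refine ⟨a, b, p - a, q - b, hb, hd, ?_, ?_, ?_, ?_, by ring, by ring,
    by linear_combination hdet⟩ <;> refine le_of_mul_le_mul_right ?_ hq' <;>
    nlinarith [mul_le_mul_of_nonneg_right (Int.add_one_le_iff.mpr hk) hb.le,
      mul_le_mul_of_nonneg_right (Int.add_one_le_iff.mpr hk') hb.le,
      mul_le_mul_of_nonneg_right (Int.add_one_le_iff.mpr hk) hd.le,
      mul_le_mul_of_nonneg_right (Int.add_one_le_iff.mpr hk') hd.le]

/-- For nonnegative vectors of determinant one, the coordinatewise absolute difference is the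
difference up to a common sign. -/
theorem exists_common_sign_abs_sub {a b c d : ℤ} (ha : 0 ≤ a) (hb : 0 < b) (hc : 0 ≤ c)
    (hd : 0 < d) (hdet : c * b - a * d = 1 ∨ c * b - a * d = -1) :
    ∃ e : ℤ, (e = 1 ∨ e = -1) ∧ |a - c| = e * (a - c) ∧ |b - d| = e * (b - d) := by
  rcases le_total a c with hac | hac <;> rcases le_total b d with hbd | hbd
  · exact ⟨-1, .inr rfl, by rw [abs_of_nonpos] <;> lia, by rw [abs_of_nonpos] <;> lia⟩
  · rcases hac.eq_or_lt with rfl | hac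
    · exact ⟨1, .inl rfl, by simp, by rw [abs_of_nonneg] <;> lia⟩
    rcases hbd.eq_or_lt with rfl | hbd
    · exact ⟨-1, .inr rfl, by rw [abs_of_neg] <;> lia, by simp⟩
    rcases hdet with h | h <;> nlinarith
  · rcases hac.eq_or_lt with rfl | hac
    · exact ⟨-1, .inr rfl, by simp, by rw [abs_of_nonpos] <;> lia⟩
    rcases hbd.eq_or_lt with rfl | hbd
    · exact ⟨1, .inl rfl, by rw [abs_of_pos] <;> lia, by simp⟩
    rcases hdet with h | h <;> nlinarith
  · exact ⟨1, .inl rfl, by rw [abs_of_nonneg] <;> lia, by rw [abs_of_nonneg] <;> lia⟩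

/-- If all the vectors involved lie in a common quadrant, then the vector of absolute differences,
with the signs of that quadrant, is the difference up to sign. -/
theorem exists_sign_mul_abs_sub {s t a b c d : ℤ} (hs : s = 1 ∨ s = -1) (ht : t = 1 ∨ t = -1)
    (ha : 0 ≤ t * a) (hb : 0 < s * b) (hc : 0 ≤ t * c) (hd : 0 < s * d)
    (hdet : c * b - a * d = 1) :
    ∃ e : ℤ, (e = 1 ∨ e = -1) ∧ t * |a - c| = e * (a - c) ∧ s * |b - d| = e * (b - d) := by
  have hss : s * s = 1 := by rcases hs with rfl | rfl <;> rfl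
  have htt : t * t = 1 := by rcases ht with rfl | rfl <;> rfl
  have hs' : |s| = 1 := by rcases hs with rfl | rfl <;> rfl
  have ht' : |t| = 1 := by rcases ht with rfl | rfl <;> rfl
  obtain ⟨e, he, hac, hbd⟩ := exists_common_sign_abs_sub ha hb hc hd (by
    have : t * c * (s * b) - t * a * (s * d) = t * s := by linear_combination t * s * hdet
    rw [this]
    rcases hs with rfl | rfl <;> rcases ht with rfl | rfl <;> simp)
  rw [← mul_sub, abs_mul, ht', one_mul] at hac
  rw [← mul_sub, abs_mul, hs', one_mul] at hbd
  exact ⟨e, he, by rw [hac]; linear_combination e * (a - c) * htt,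
    by rw [hbd]; linear_combination e * (b - d) * hss⟩

theorem Int.sign_eq_of_mul_nonneg {t a : ℤ} (ht : t = 1 ∨ t = -1) (h : 0 ≤ t * a) (ha : a ≠ 0) :
    a.sign = t := by
  rcases ht with rfl | rfl
  · exact Int.sign_eq_one_of_pos (by lia)
  · exact Int.sign_eq_neg_one_of_neg (by lia)

theorem Int.sign_eq_one_or_neg_one {a : ℤ} (ha : a ≠ 0) : a.sign = 1 ∨ a.sign = -1 := by
  rcases ha.lt_or_gt with h | h
  · exact .inr (Int.sign_eq_neg_one_of_neg h)
  · exact .inl (Int.sign_eq_one_of_pos h)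

theorem div_mem_Icc_of_mul_le {a b k : ℤ} (hb : 0 < b) (h : k * b ≤ a) (h' : a ≤ (k + 1) * b) :
    (a : ℚ) / (b : ℚ) ∈ Set.Icc (k : ℚ) ((k : ℚ) + 1) := by
  have : (0 : ℚ) < b := by exact_mod_cast hb
  constructor
  · rw [le_div_iff₀ this]; exact_mod_cast h
  · rw [div_le_iff₀ this]; exact_mod_cast h'


/-- Lemma 6.1: existence of smaller surgery slopes fitting into two slope triads. -/
theorem existence_of_smaller_surgery_slopes
    (p₀ q₀ k : ℤ) (hcop : IsCoprime p₀ q₀) (hp₀ : p₀ ≠ 0) (hq₀ : 1 < |q₀|)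
    (hmem : (p₀ : ℚ) / (q₀ : ℚ) ∈ Set.Ioo (k : ℚ) ((k : ℚ) + 1)) :
    ∃ p₁ q₁ p₂ q₂ p₃ q₃ : ℤ,
      (IsCoprime p₁ q₁ ∧ IsCoprime p₂ q₂ ∧ IsCoprime p₃ q₃) ∧
      ((p₁ ≠ 0 → p₁.sign = p₀.sign) ∧ (q₁ ≠ 0 → q₁.sign = q₀.sign) ∧
       (p₂ ≠ 0 → p₂.sign = p₀.sign) ∧ (q₂ ≠ 0 → q₂.sign = q₀.sign) ∧
       (p₃ ≠ 0 → p₃.sign = p₀.sign) ∧ (q₃ ≠ 0 → q₃.sign = q₀.sign)) ∧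
      (q₁ ≠ 0 ∧ q₂ ≠ 0 ∧
        (p₁ : ℚ) / (q₁ : ℚ) ∈ Set.Icc (k : ℚ) ((k : ℚ) + 1) ∧
        (p₂ : ℚ) / (q₂ : ℚ) ∈ Set.Icc (k : ℚ) ((k : ℚ) + 1)) ∧
      (p₁ + p₂ = p₀ ∧ q₁ + q₂ = q₀) ∧
      (p₃ = p₀.sign * |p₁ - p₂| ∧ q₃ = q₀.sign * |q₁ - q₂|) ∧
      (∃ σ₁ σ₂ σ₃ ε ε' : ℤ,
        (σ₁ = 1 ∨ σ₁ = -1) ∧ (σ₂ = 1 ∨ σ₂ = -1) ∧ (σ₃ = 1 ∨ σ₃ = -1) ∧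
        (ε = 1 ∨ ε = -1) ∧ (ε' = 1 ∨ ε' = -1) ∧
        p₀ * (σ₁ * q₁) - (σ₁ * p₁) * q₀ = ε ∧
        (σ₁ * p₁) * (σ₂ * q₂) - (σ₂ * p₂) * (σ₁ * q₁) = ε ∧
        (σ₂ * p₂) * q₀ - p₀ * (σ₂ * q₂) = ε ∧
        (σ₂ * p₂) * (σ₃ * q₃) - (σ₃ * p₃) * (σ₂ * q₂) = ε' ∧
        (σ₁ * p₁) * (σ₃ * q₃) - (σ₃ * p₃) * (σ₁ * q₁) = ε') := by
  have hq : q₀ ≠ 0 := by rintro rfl; simp at hq₀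
  have hs := Int.sign_eq_one_or_neg_one hq
  have ht := Int.sign_eq_one_or_neg_one hp₀
  have hsq : q₀.sign * q₀ = |q₀| := Int.sign_mul_self_eq_abs q₀
  have htp : 0 < p₀.sign * p₀ := by rw [Int.sign_mul_self_eq_abs]; exact abs_pos.mpr hp₀
  set s := q₀.sign
  set t := p₀.sign
  have hss : s * s = 1 := by rcases hs with h | h <;> rw [h] <;> rfl
  have hs0 : (s : ℚ) ≠ 0 := by rcases hs with h | h <;> simp [h]
  have hscale (x y : ℤ) : ((s * x : ℤ) : ℚ) / ((s * y : ℤ) : ℚ) = (x : ℚ) / (y : ℚ) := by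
    push_cast; exact mul_div_mul_left _ _ hs0
  have hsq1 : 1 < s * q₀ := hsq ▸ hq₀
  have hsqQ : (0 : ℚ) < ((s * q₀ : ℤ) : ℚ) := by exact_mod_cast one_pos.trans hsq1
  rw [← hscale, Set.mem_Ioo, lt_div_iff₀ hsqQ, div_lt_iff₀ hsqQ] at hmem
  have hk : k * (s * q₀) < s * p₀ := by exact_mod_cast hmem.1
  have hk' : s * p₀ < (k + 1) * (s * q₀) := by exact_mod_cast hmem.2
  have hunit : IsUnit s := Int.isUnit_iff.mpr hs
  obtain ⟨a, b, c, d, hb, hd, hka, hak, hkc, hck, hac, hbd, hdet⟩ :=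
    exists_mediant_decomposition
      ((isCoprime_mul_unit_left hunit p₀ q₀).mpr hcop) hsq1 hk hk'
  have hquad {x y : ℤ} (hy : 0 < y) (h : k * y ≤ x) (h' : x ≤ (k + 1) * y) :
      0 ≤ t * (s * x) := by
    have hts : t * s = 1 ∧ 0 ≤ k ∨ t * s = -1 ∧ k + 1 ≤ 0 := by
      rcases hs with h1 | h1 <;> rcases ht with h2 | h2 <;>
        simp only [h1, h2] at hk hk' htp hsq1 ⊢ <;> norm_num at * <;>
        by_contra! <;> nlinarith
    rcases hts with ⟨h1, h2⟩ | ⟨h1, h2⟩ <;> rw [← mul_assoc, h1] <;> nlinarith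
  have hta := hquad hb hka hak
  have htc := hquad hd hkc hck
  have hcancel (x : ℤ) : s * (s * x) = x := by rw [← mul_assoc, hss, one_mul]
  have hdet' : s * c * (s * b) - s * a * (s * d) = 1 := by
    linear_combination hdet + (c * b - a * d) * hss
  obtain ⟨e, he, hp₃, hq₃⟩ := exists_sign_mul_abs_sub hs ht hta
    (by rwa [hcancel]) htc (by rwa [hcancel]) hdet'
  have hp : s * a + s * c = p₀ := by rw [← mul_add, hac, hcancel]
  have hq' : s * b + s * d = q₀ := by rw [← mul_add, hbd, hcancel]
  have hee : e * e = 1 := by rcases he with rfl | rfl <;> rfl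
  have hnn {r : ℤ} (hr : r = 1 ∨ r = -1) (x : ℤ) : 0 ≤ r * (r * |x|) := by
    rcases hr with rfl | rfl <;> simp
  refine ⟨s * a, s * b, s * c, s * d, t * |s * a - s * c|, s * |s * b - s * d|,
    ⟨⟨-(s * d), s * c, by linear_combination hdet'⟩, ⟨s * b, -(s * a), by linear_combination hdet'⟩,
      ?_⟩,
    ⟨Int.sign_eq_of_mul_nonneg ht hta, Int.sign_eq_of_mul_nonneg hs (by rw [hcancel]; exact hb.le),
      Int.sign_eq_of_mul_nonneg ht htc, Int.sign_eq_of_mul_nonneg hs (by rw [hcancel]; exact hd.le),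
      Int.sign_eq_of_mul_nonneg ht (hnn ht _), Int.sign_eq_of_mul_nonneg hs (hnn hs _)⟩,
    ⟨?_, ?_, ?_, ?_⟩, ⟨hp, hq'⟩, ⟨rfl, rfl⟩, ⟨-1, -1, 1, -1, -e, ?_⟩⟩
  · rw [hp₃, hq₃]
    exact ⟨-(e * (s * d)), e * (s * c), by
      linear_combination hdet' + (s * c * (s * b) - s * a * (s * d)) * hee⟩
  · exact mul_ne_zero hunit.ne_zero hb.ne'
  · exact mul_ne_zero hunit.ne_zero hd.ne'
  · rw [hscale]; exact div_mem_Icc_of_mul_le hb hka hak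
  · rw [hscale]; exact div_mem_Icc_of_mul_le hd hkc hck
  · refine ⟨.inr rfl, .inr rfl, .inl rfl, .inr rfl, by rcases he with rfl | rfl <;> simp,
      ?_, ?_, ?_, ?_, ?_⟩
    · rw [← hp, ← hq']; linear_combination -hdet'
    · linear_combination -hdet'
    · rw [← hp, ← hq']; linear_combination -hdet'
    · rw [hp₃, hq₃]; linear_combination -e * hdet'
    · rw [hp₃, hq₃]; linear_combination -e * hdet'
end

section
/- Under these hypotheses, the sequence B₁ → C ⊕ C′ → A is exact at C ⊕ C′, where the first map sends w to (g(w), c(w)) and the second map sends (u, v) to e(u) + e′(v): the kernel of the map (u, v) ↦ e(u) + e′(v) equals the image of the map w ↦ (g(w), c(w)). -/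
/-- Exactness at C ⊕ C' in the distance-two surgery exact triangle. -/
theorem distance_two_exact_at_CC' {R : Type*} [CommRing R]
    {A B₀ B₁ C C' : Type*} [AddCommGroup A] [AddCommGroup B₀] [AddCommGroup B₁]
    [AddCommGroup C] [AddCommGroup C'] [Module R A] [Module R B₀] [Module R B₁]
    [Module R C] [Module R C']
    (a : C' →ₗ[R] B₀) (b : B₀ →ₗ[R] B₁) (c : B₁ →ₗ[R] C')
    (d : B₀ →ₗ[R] C) (e : C →ₗ[R] A) (f : A →ₗ[R] B₀)
    (g : B₁ →ₗ[R] C) (e' : C' →ₗ[R] A)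
    (hba : LinearMap.ker b = LinearMap.range a)
    (hcb : LinearMap.ker c = LinearMap.range b)
    (hac : LinearMap.ker a = LinearMap.range c)
    (hed : LinearMap.ker e = LinearMap.range d)
    (hfe : LinearMap.ker f = LinearMap.range e)
    (hdf : LinearMap.ker d = LinearMap.range f)
    (h1 : e ∘ₗ g + e' ∘ₗ c = 0)
    (h2 : f ∘ₗ e' = a ∨ f ∘ₗ e' = -a)
    (h3 : g ∘ₗ b = d ∨ g ∘ₗ b = -d) :
    LinearMap.ker (LinearMap.coprod e e') = LinearMap.range (LinearMap.prod g c) := by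
  have hge (w : B₁) : e (g w) + e' (c w) = 0 := LinearMap.congr_fun h1 w
  have hcb0 (x : B₀) : c (b x) = 0 := LinearMap.mem_ker.1 (hcb ▸ LinearMap.mem_range_self b x)
  have hfe0 (u : C) : f (e u) = 0 := LinearMap.mem_ker.1 (hfe ▸ LinearMap.mem_range_self e u)
  refine le_antisymm ?_ ?_
  · rintro ⟨u, v⟩ huv
    replace huv : e u + e' v = 0 := by simpa using huv
    have hfv : f (e' v) = 0 := by simpa [hfe0] using congrArg f huv
    have hav : a v = 0 := by
      rcases h2 with h | h
      · simpa [hfv] using (LinearMap.congr_fun h v).symm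
      · simpa [hfv] using (LinearMap.congr_fun h v).symm
    obtain ⟨w, rfl⟩ : v ∈ LinearMap.range c := hac ▸ LinearMap.mem_ker.2 hav
    have hker : e (u - g w) = 0 := by
      rw [map_sub, sub_eq_zero]
      exact add_right_cancel (huv.trans (hge w).symm)
    obtain ⟨x, hx⟩ : u - g w ∈ LinearMap.range d := hed ▸ LinearMap.mem_ker.2 hker
    rcases h3 with h | h
    · have hgb : g (b x) = d x := LinearMap.congr_fun h x
      exact ⟨w + b x, by simp [hgb, hx, hcb0]⟩
    · have hgb : g (b x) = -d x := LinearMap.congr_fun h x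
      exact ⟨w - b x, by simp [hgb, hx, hcb0]⟩
  · rintro _ ⟨w, rfl⟩
    simpa using hge w
end

section
/- Under these hypotheses, the sequence C ⊕ C′ → A → B₁ is exact at A, where the first map sends (u, v) to e(u) + e′(v) and the second map is the composite b∘f: the kernel of b∘f equals the image of the map (u, v) ↦ e(u) + e′(v). -/
/-- Exactness at A in the distance-two surgery exact triangle. -/
theorem distance_two_exact_at_A {R : Type*} [CommRing R]
    {A B₀ B₁ C C' : Type*} [AddCommGroup A] [AddCommGroup B₀] [AddCommGroup B₁]
    [AddCommGroup C] [AddCommGroup C'] [Module R A] [Module R B₀] [Module R B₁]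
    [Module R C] [Module R C']
    (a : C' →ₗ[R] B₀) (b : B₀ →ₗ[R] B₁) (c : B₁ →ₗ[R] C')
    (d : B₀ →ₗ[R] C) (e : C →ₗ[R] A) (f : A →ₗ[R] B₀)
    (g : B₁ →ₗ[R] C) (e' : C' →ₗ[R] A)
    (hba : LinearMap.ker b = LinearMap.range a)
    (hcb : LinearMap.ker c = LinearMap.range b)
    (hac : LinearMap.ker a = LinearMap.range c)
    (hed : LinearMap.ker e = LinearMap.range d)
    (hfe : LinearMap.ker f = LinearMap.range e)
    (hdf : LinearMap.ker d = LinearMap.range f)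
    (h1 : e ∘ₗ g + e' ∘ₗ c = 0)
    (h2 : f ∘ₗ e' = a ∨ f ∘ₗ e' = -a)
    (h3 : g ∘ₗ b = d ∨ g ∘ₗ b = -d) :
    LinearMap.ker (b ∘ₗ f) = LinearMap.range (LinearMap.coprod e e') := by
  have hr : LinearMap.range (f ∘ₗ e') = LinearMap.ker b := by
    rcases h2 with h | h <;> simp [h, hba, LinearMap.range_neg]
  ext x
  constructor
  · intro hx
    have hfx : f x ∈ LinearMap.range (f ∘ₗ e') := hr ▸ hx
    obtain ⟨v, hv⟩ := hfx
    have hxv : x - e' v ∈ LinearMap.range e := by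
      rw [← hfe, LinearMap.mem_ker, map_sub, sub_eq_zero]
      exact hv.symm
    obtain ⟨u, hu⟩ := hxv
    exact ⟨(u, v), by simp [hu]⟩
  · rintro ⟨⟨u, v⟩, rfl⟩
    have hu : f (e u) = 0 := LinearMap.mem_ker.mp (hfe ▸ LinearMap.mem_range_self e u)
    have hv : b (f (e' v)) = 0 :=
      LinearMap.mem_ker.mp (hr ▸ LinearMap.mem_range_self (f ∘ₗ e') v)
    simp [hu, hv]
end

section
/- Under these hypotheses, the sequence A → B₁ → C ⊕ C′ is exact at B₁, where the first map is the composite b∘f and the second map sends w to (g(w), c(w)): the kernel of the map w ↦ (g(w), c(w)) equals the image of b∘f. -/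
/-- Exactness at B₁ in the distance-two surgery exact triangle. -/
theorem distance_two_exact_at_B₁ {R : Type*} [CommRing R]
    {A B₀ B₁ C C' : Type*} [AddCommGroup A] [AddCommGroup B₀] [AddCommGroup B₁]
    [AddCommGroup C] [AddCommGroup C'] [Module R A] [Module R B₀] [Module R B₁]
    [Module R C] [Module R C']
    (a : C' →ₗ[R] B₀) (b : B₀ →ₗ[R] B₁) (c : B₁ →ₗ[R] C')
    (d : B₀ →ₗ[R] C) (e : C →ₗ[R] A) (f : A →ₗ[R] B₀)
    (g : B₁ →ₗ[R] C) (e' : C' →ₗ[R] A)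
    (hba : LinearMap.ker b = LinearMap.range a)
    (hcb : LinearMap.ker c = LinearMap.range b)
    (hac : LinearMap.ker a = LinearMap.range c)
    (hed : LinearMap.ker e = LinearMap.range d)
    (hfe : LinearMap.ker f = LinearMap.range e)
    (hdf : LinearMap.ker d = LinearMap.range f)
    (h1 : e ∘ₗ g + e' ∘ₗ c = 0)
    (h2 : f ∘ₗ e' = a ∨ f ∘ₗ e' = -a)
    (h3 : g ∘ₗ b = d ∨ g ∘ₗ b = -d) :
    LinearMap.ker (LinearMap.prod g c) = LinearMap.range (b ∘ₗ f) := by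
  have hgb (x : B₀) : g (b x) = 0 ↔ x ∈ LinearMap.range f := by
    rw [← hdf, LinearMap.mem_ker]
    rcases h3 with h | h
    · rw [← h, LinearMap.comp_apply]
    · rw [← LinearMap.comp_apply, h, LinearMap.neg_apply, neg_eq_zero]
  rw [LinearMap.ker_prod, hcb, LinearMap.range_comp]
  ext w
  constructor
  · rintro ⟨hw, x, rfl⟩
    exact ⟨x, (hgb x).mp hw, rfl⟩
  · rintro ⟨x, hx, rfl⟩
    exact ⟨(hgb x).mpr hx, x, rfl⟩
end

section
/- Let K be a field of characteristic different from 2, let V be a K-vector space that is the internal direct sum of two subspaces A and B, and let f : V → V be a K-linear endomorphism with f(A) ⊆ B and f(B) ⊆ A. Then for every natural number N and all vectors x ∈ A and y ∈ B, one has (f + 2·id)^N (x + y) = 0 if and only if (f − 2·id)^N (x − y) = 0. -/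
theorem Submodule.add_eq_zero_iff_sub_eq_zero_of_disjoint
    {R M : Type*} [Ring R] [AddCommGroup M] [Module R M] {A B : Submodule R M}
    (h : Disjoint A B) {x y : M} (hx : x ∈ A) (hy : y ∈ B) :
    x + y = 0 ↔ x - y = 0 := by
  rw [Submodule.disjoint_def] at h
  constructor <;> intro hxy
  · have hy0 : y = 0 := h y (by simpa [eq_neg_of_add_eq_zero_right hxy] using hx) hy
    simpa [hy0] using hxy
  · have hy0 : y = 0 := h y (by simpa [← sub_eq_zero.mp hxy] using hx) hy
    simpa [hy0] using hxy

theorem Module.End.pow_add_smul_one_apply_add_eq_zero_iff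
    {R M : Type*} [CommRing R] [AddCommGroup M] [Module R M] {A B : Submodule R M}
    (h : Disjoint A B) {f : Module.End R M} (hfA : ∀ x ∈ A, f x ∈ B) (hfB : ∀ y ∈ B, f y ∈ A)
    (c : R) (n : ℕ) {x y : M} (hx : x ∈ A) (hy : y ∈ B) :
    ((f + c • (1 : Module.End R M)) ^ n) (x + y) = 0 ↔
      ((f - c • (1 : Module.End R M)) ^ n) (x - y) = 0 := by
  induction n generalizing x y with
  | zero => simpa using Submodule.add_eq_zero_iff_sub_eq_zero_of_disjoint h hx hy
  | succ n ih =>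
    have hplus : (f + c • (1 : Module.End R M)) (x + y) = (c • x + f y) + (f x + c • y) := by
      simp only [LinearMap.add_apply, LinearMap.smul_apply, Module.End.one_apply, map_add]
      abel
    have hminus : (f - c • (1 : Module.End R M)) (x - y) = -((c • x + f y) - (f x + c • y)) := by
      simp only [LinearMap.sub_apply, LinearMap.smul_apply, Module.End.one_apply, map_sub]
      abel
    rw [pow_succ, pow_succ, Module.End.mul_apply, Module.End.mul_apply, hplus, hminus, map_neg,
      neg_eq_zero]
    exact ih (A.add_mem (A.smul_mem c hx) (hfB y hy)) (B.add_mem (hfA x hx) (B.smul_mem c hy))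

/-- For a degree-4 operator on a space split into two families of gradings differing
by 4, vanishing of `(f+2)^N (x+y)` is equivalent to vanishing of `(f-2)^N (x-y)`. -/
theorem pow_add_two_eq_zero_iff
    {K V : Type*} [Field K] (hchar : ringChar K ≠ 2)
    [AddCommGroup V] [Module K V]
    (A B : Submodule K V) (hAB : IsCompl A B)
    (f : Module.End K V) (hfA : ∀ x ∈ A, f x ∈ B) (hfB : ∀ y ∈ B, f y ∈ A)
    (N : ℕ) (x y : V) (hx : x ∈ A) (hy : y ∈ B) :
    ((f + (2 : K) • (1 : Module.End K V)) ^ N) (x + y) = 0 ↔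
      ((f - (2 : K) • (1 : Module.End K V)) ^ N) (x - y) = 0 :=
  Module.End.pow_add_smul_one_apply_add_eq_zero_iff hAB.disjoint hfA hfB 2 N hx hy
end

section
/- Let K be a field of characteristic different from 2 and let V be a finite-dimensional K-vector space that is the internal direct sum of two subspaces A and B. Let f : V → V be a K-linear endomorphism with f(A) ⊆ B and f(B) ⊆ A, and suppose (f∘f − 4·id)^N = 0 for some natural number N. Then the generalized eigenspaces of f for the eigenvalues 2 and −2 have the same dimension, and twice this common dimension equals dim V; here the generalized eigenspace for an eigenvalue λ is the union over all n of the kernel of (f − λ·id)^n. -/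
section

variable {K V : Type*} [Field K] [AddCommGroup V] [Module K V]

theorem IsCompl.exists_involution_anticomm {A B : Submodule K V} (hAB : IsCompl A B)
    {f : Module.End K V} (hfA : ∀ x ∈ A, f x ∈ B) (hfB : ∀ y ∈ B, f y ∈ A) :
    ∃ s : Module.End K V, (∀ v, s (s v) = v) ∧ ∀ v, f (s v) = -s (f v) := by
  have hl : ∀ x ∈ A, LinearMap.ofIsCompl hAB A.subtype (-B.subtype) x = x := fun x hx =>
    LinearMap.ofIsCompl_apply_left hAB ⟨x, hx⟩
  have hr : ∀ x ∈ B, LinearMap.ofIsCompl hAB A.subtype (-B.subtype) x = -x := fun x hx =>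
    LinearMap.ofIsCompl_apply_right hAB ⟨x, hx⟩
  refine ⟨LinearMap.ofIsCompl hAB A.subtype (-B.subtype), fun v => ?_, fun v => ?_⟩ <;>
  · obtain ⟨a, ha, b, hb, rfl⟩ :=
      Submodule.mem_sup.mp (hAB.sup_eq_top ▸ Submodule.mem_top : v ∈ A ⊔ B)
    simp [hl a ha, hr b hb, hr _ (hfA a ha), hl _ (hfB b hb), add_comm]

theorem Module.End.apply_mem_ker_sub_smul_neg_pow {f s : Module.End K V}
    (hs : ∀ v, f (s v) = -s (f v)) (μ : K) (n : ℕ) {v : V}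
    (hv : v ∈ LinearMap.ker ((f - μ • (1 : Module.End K V)) ^ n)) :
    s v ∈ LinearMap.ker ((f - (-μ) • (1 : Module.End K V)) ^ n) := by
  induction n generalizing v with
  | zero => simp_all
  | succ n ih =>
    rw [LinearMap.mem_ker, pow_succ, Module.End.mul_apply, ← LinearMap.mem_ker] at hv ⊢
    have h : (f - (-μ) • (1 : Module.End K V)) (s v)
        = -s ((f - μ • (1 : Module.End K V)) v) := by
      simp [hs]
      abel
    rw [h]
    exact neg_mem (ih hv)

theorem Module.End.finrank_iSup_ker_le_of_anticomm [FiniteDimensional K V]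
    {f s : Module.End K V} (hss : ∀ v, s (s v) = v) (hs : ∀ v, f (s v) = -s (f v)) (μ : K) :
    Module.finrank K
        (⨆ n : ℕ, LinearMap.ker ((f - μ • (1 : Module.End K V)) ^ n) : Submodule K V)
      ≤ Module.finrank K
        (⨆ n : ℕ, LinearMap.ker ((f - (-μ) • (1 : Module.End K V)) ^ n) : Submodule K V) := by
  have hinj : Function.Injective s := Function.LeftInverse.injective hss
  rw [(Submodule.equivMapOfInjective s hinj _).finrank_eq]
  refine Submodule.finrank_mono ?_
  rw [Submodule.map_iSup]
  exact iSup_mono fun n => Submodule.map_le_iff_le_comap.mpr fun v hv =>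
    apply_mem_ker_sub_smul_neg_pow hs μ n hv

theorem Module.End.isCompl_iSup_ker_of_pow_eq_zero {f : Module.End K V} {μ ν : K} (h : μ ≠ ν)
    {N : ℕ} (hN : ((f - μ • (1 : Module.End K V)) * (f - ν • (1 : Module.End K V))) ^ N = 0) :
    IsCompl (⨆ n : ℕ, LinearMap.ker ((f - μ • (1 : Module.End K V)) ^ n))
      (⨆ n : ℕ, LinearMap.ker ((f - ν • (1 : Module.End K V)) ^ n)) := by
  constructor
  · have := Module.End.disjoint_genEigenspace f h ⊤ ⊤
    simpa only [Module.End.genEigenspace_top, Module.End.genEigenspace_nat] using this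
  · have hco : IsCoprime ((Polynomial.X - Polynomial.C μ) ^ N)
        ((Polynomial.X - Polynomial.C ν) ^ N) :=
      (Polynomial.isCoprime_X_sub_C_of_isUnit_sub (sub_ne_zero.mpr h).isUnit).pow
    have key := Polynomial.sup_ker_aeval_eq_ker_aeval_mul_of_coprime f hco
    rw [← mul_pow] at key
    simp only [map_pow, map_mul, map_sub, Polynomial.aeval_X, Polynomial.aeval_C,
      Algebra.algebraMap_eq_smul_one] at key
    rw [hN, LinearMap.ker_zero] at key
    rw [codisjoint_iff, eq_top_iff, ← key]
    exact sup_le_sup (le_iSup (fun n : ℕ => LinearMap.ker ((f - μ • (1 : Module.End K V)) ^ n)) N)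
      (le_iSup (fun n : ℕ => LinearMap.ker ((f - ν • (1 : Module.End K V)) ^ n)) N)

end


/-- The (+2)- and (−2)-generalized eigenspaces of the point operator have equal
dimension, and twice this common dimension is the total dimension. -/
theorem gen_eigenspace_dims_eq
    {K V : Type*} [Field K] (hchar : ringChar K ≠ 2)
    [AddCommGroup V] [Module K V] [FiniteDimensional K V]
    (A B : Submodule K V) (hAB : IsCompl A B)
    (f : Module.End K V) (hfA : ∀ x ∈ A, f x ∈ B) (hfB : ∀ y ∈ B, f y ∈ A)
    (N : ℕ) (hN : (f * f - (4 : K) • (1 : Module.End K V)) ^ N = 0) :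
    Module.finrank K
        (⨆ n : ℕ, LinearMap.ker ((f - (2 : K) • (1 : Module.End K V)) ^ n) : Submodule K V)
      = Module.finrank K
        (⨆ n : ℕ, LinearMap.ker ((f - (-2 : K) • (1 : Module.End K V)) ^ n) : Submodule K V) ∧
    2 * Module.finrank K
        (⨆ n : ℕ, LinearMap.ker ((f - (2 : K) • (1 : Module.End K V)) ^ n) : Submodule K V)
      = Module.finrank K V := by
  obtain ⟨s, hss, hs⟩ := hAB.exists_involution_anticomm hfA hfB
  have h2 : (2 : K) ≠ 0 := Ring.two_ne_zero hchar
  have hne : (2 : K) ≠ -2 := by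
    intro h
    have h4 : (2 : K) * 2 = 0 := by linear_combination h
    exact mul_ne_zero h2 h2 h4
  have hle := Module.End.finrank_iSup_ker_le_of_anticomm hss hs 2
  have hge := Module.End.finrank_iSup_ker_le_of_anticomm hss hs (-2)
  rw [neg_neg] at hge
  have heq := le_antisymm hle hge
  have hfac : (f - (2 : K) • (1 : Module.End K V)) * (f - (-2 : K) • (1 : Module.End K V))
      = f * f - (4 : K) • (1 : Module.End K V) := by
    ext v
    simp
    module
  have hsum := Submodule.finrank_add_eq_of_isCompl
    (Module.End.isCompl_iSup_ker_of_pow_eq_zero hne (hfac ▸ hN))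
  exact ⟨heq, by omega⟩
end
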